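/- arXiv:2309.15355 — 3 statements merged into one kernel-verified Lean document; each statement's English description precedes it below -/
import Mathlib

section
/- Let X be an n×p real matrix and s₀ an integer with 1 ≤ 3s₀ ≤ p, and suppose Λ_min(2s₀) > 0. Let h ∈ ℝ^p, let T₀ ⊆ {1,…,p} with |T₀| = s₀, let T₁ be a set of indices of the s₀ largest coordinates of h in absolute value outside T₀, and set T₀₁ = T₀ ∪ T₁. Then ‖X h_{T₀₁}‖₂/√n ≤ ‖Xh‖₂/√n + √Λ_max(s₀)·‖h_{T₀^c}‖₁/√s₀, and consequently ‖h_{T₀₁}‖₂ ≤ (1/√Λ_min(2s₀))·(‖Xh‖₂/√n + ℓ(s₀)·‖h_{T₀^c}‖₁/√s₀), where ℓ(s₀) = min(θ_{s₀,2s₀}/√Λ_min(2s₀), √Λ_max(s₀)). -/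
open Finset Matrix Real
open scoped BigOperators Classical

noncomputable section

namespace ThreshLasso

/-- ℓ₂ norm of a finite real vector. -/
def l2 {m : ℕ} (v : Fin m → ℝ) : ℝ := Real.sqrt (∑ i, (v i) ^ 2)

/-- ℓ₁ norm of a finite real vector. -/
def l1 {m : ℕ} (v : Fin m → ℝ) : ℝ := ∑ i, |v i|

/-- Restriction of a vector to a set of coordinates (zero outside). -/
def restr {p : ℕ} (v : Fin p → ℝ) (T : Finset (Fin p)) : Fin p → ℝ :=
  fun j => if j ∈ T then v j else 0

/-- Support of a vector, as a `Finset`. -/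
def supp {p : ℕ} (v : Fin p → ℝ) : Finset (Fin p) :=
  Finset.univ.filter fun j => v j ≠ 0

/-- `L` is the minimal `m`-sparse eigenvalue `Λ_min(m)` of `X`:
the least value of `‖Xv‖₂²/(n‖v‖₂²)` over nonzero `v` with at most `m`
nonzero coordinates. -/
def IsLambdaMin {n p : ℕ} (X : Matrix (Fin n) (Fin p) ℝ) (m : ℕ) (L : ℝ) : Prop :=
  IsLeast {r : ℝ | ∃ v : Fin p → ℝ, v ≠ 0 ∧ (supp v).card ≤ m ∧
    r = (l2 (X.mulVec v)) ^ 2 / (n * (l2 v) ^ 2)} L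

/-- `L` is the maximal `m`-sparse eigenvalue `Λ_max(m)` of `X`
(with the convention `Λ_max(0) = 0`, implemented by inserting `0` in the set,
which does not change the maximum when `m ≥ 1`). -/
def IsLambdaMax {n p : ℕ} (X : Matrix (Fin n) (Fin p) ℝ) (m : ℕ) (L : ℝ) : Prop :=
  IsGreatest (insert (0 : ℝ) {r : ℝ | ∃ v : Fin p → ℝ, v ≠ 0 ∧ (supp v).card ≤ m ∧
    r = (l2 (X.mulVec v)) ^ 2 / (n * (l2 v) ^ 2)}) L

/-- `θ` is the restricted orthogonality constant `θ_{m,m'}` of `X`: the smallest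
nonnegative `t` such that `|⟨Xu, Xu'⟩|/n ≤ t‖u‖₂‖u'‖₂` for all `u, u'` supported
on disjoint sets of cardinality at most `m`, `m'` respectively. -/
def IsTheta {n p : ℕ} (X : Matrix (Fin n) (Fin p) ℝ) (m m' : ℕ) (θ : ℝ) : Prop :=
  IsLeast {t : ℝ | 0 ≤ t ∧ ∀ (u u' : Fin p → ℝ) (T T' : Finset (Fin p)),
    Disjoint T T' → T.card ≤ m → T'.card ≤ m' →
    (∀ j, j ∉ T → u j = 0) → (∀ j, j ∉ T' → u' j = 0) →
    |∑ i, (X.mulVec u i) * (X.mulVec u' i)| / n ≤ t * (l2 u * l2 u')} θ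

/-- Restricted eigenvalue condition `RE(s₀, k₀, X)` with constant `K`. -/
def RECond {n p : ℕ} (X : Matrix (Fin n) (Fin p) ℝ) (s₀ : ℕ) (k₀ K : ℝ) : Prop :=
  0 < K ∧ ∀ (v : Fin p → ℝ) (J : Finset (Fin p)), J.card ≤ s₀ →
    l1 (restr v Jᶜ) ≤ k₀ * l1 (restr v J) →
    l2 (restr v J) / K ≤ l2 (X.mulVec v) / Real.sqrt n

/-- `s₀` is the essential sparsity of `β`: the smallest nonnegative integer `m`
with `∑ᵢ min(βᵢ², λ²σ²) ≤ m λ²σ²`. -/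
def EssSparsity {p : ℕ} (β : Fin p → ℝ) (lam σ : ℝ) (s₀ : ℕ) : Prop :=
  IsLeast {m : ℕ | ∑ i, min ((β i) ^ 2) (lam ^ 2 * σ ^ 2) ≤ (m : ℝ) * (lam ^ 2 * σ ^ 2)} s₀

/-- `T₀` is a set of indices of the `s₀` largest coordinates of `β` in absolute value. -/
def TopSet {p : ℕ} (β : Fin p → ℝ) (s₀ : ℕ) (T₀ : Finset (Fin p)) : Prop :=
  T₀.card = s₀ ∧ ∀ i ∈ T₀, ∀ j, j ∉ T₀ → |β j| ≤ |β i|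

/-- `T₁` is a set of indices of the `s₀` largest coordinates of `h` in absolute
value outside `T₀`. -/
def TopSetOutside {p : ℕ} (h : Fin p → ℝ) (s₀ : ℕ) (T₀ T₁ : Finset (Fin p)) : Prop :=
  T₁.card = s₀ ∧ Disjoint T₀ T₁ ∧
    ∀ i ∈ T₁, ∀ j, j ∉ T₀ → j ∉ T₁ → |h j| ≤ |h i|

/-- `b` is a Lasso minimizer with penalty `lamn` for data `(X, Y)`. -/
def IsLassoSol {n p : ℕ} (X : Matrix (Fin n) (Fin p) ℝ) (Y : Fin n → ℝ)
    (lamn : ℝ) (b : Fin p → ℝ) : Prop :=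
  ∀ b' : Fin p → ℝ,
    1 / (2 * n) * (l2 (Y - X.mulVec b)) ^ 2 + lamn * l1 b ≤
    1 / (2 * n) * (l2 (Y - X.mulVec b')) ^ 2 + lamn * l1 b'

/-- Submatrix of the columns of `X` indexed by `I`. -/
def colSub {n p : ℕ} (X : Matrix (Fin n) (Fin p) ℝ) (I : Finset (Fin p)) :
    Matrix (Fin n) {j // j ∈ I} ℝ :=
  Matrix.of fun i j => X i j.1

/-- The Gram matrix `X_Iᵀ X_I` is invertible. -/
def GramInvertible {n p : ℕ} (X : Matrix (Fin n) (Fin p) ℝ) (I : Finset (Fin p)) : Prop :=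
  IsUnit ((colSub X I)ᵀ * colSub X I).det

/-- The OLS refit of `Y` on the columns of `X` indexed by `I`:
`(X_Iᵀ X_I)⁻¹ X_Iᵀ Y` on `I`, and `0` off `I`. -/
def olsRefit {n p : ℕ} (X : Matrix (Fin n) (Fin p) ℝ) (Y : Fin n → ℝ)
    (I : Finset (Fin p)) : Fin p → ℝ :=
  fun j => if h : j ∈ I then
    (((colSub X I)ᵀ * colSub X I)⁻¹).mulVec ((colSub X I)ᵀ.mulVec Y) ⟨j, h⟩
  else 0


theorem l2_eq_norm {m : ℕ} (v : Fin m → ℝ) : l2 v = ‖WithLp.toLp 2 v‖ := by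
  simp [l2, EuclideanSpace.norm_eq]

theorem l2_nonneg {m : ℕ} (v : Fin m → ℝ) : 0 ≤ l2 v := Real.sqrt_nonneg _

theorem l2_sq {m : ℕ} (v : Fin m → ℝ) : l2 v ^ 2 = ∑ i, v i ^ 2 :=
  Real.sq_sqrt (Finset.sum_nonneg fun _ _ => sq_nonneg _)

theorem l2_zero {m : ℕ} : l2 (0 : Fin m → ℝ) = 0 := by simp [l2]

theorem l2_pos {m : ℕ} {v : Fin m → ℝ} (hv : v ≠ 0) : 0 < l2 v := by
  rw [l2_eq_norm, norm_pos_iff]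
  simpa using hv

theorem l2_add_le {m : ℕ} (u v : Fin m → ℝ) : l2 (u + v) ≤ l2 u + l2 v := by
  simp only [l2_eq_norm, WithLp.toLp_add]
  exact norm_add_le _ _

theorem l2_sub_le {m : ℕ} (u v : Fin m → ℝ) : l2 (u - v) ≤ l2 u + l2 v := by
  simp only [l2_eq_norm, WithLp.toLp_sub]
  exact norm_sub_le _ _

theorem sum_mul_le_l2 {m : ℕ} (u v : Fin m → ℝ) : ∑ i, u i * v i ≤ l2 u * l2 v :=
  Real.sum_mul_le_sqrt_mul_sqrt _ _ _

theorem l1_restr {p : ℕ} (h : Fin p → ℝ) (S : Finset (Fin p)) :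
    l1 (restr h S) = ∑ j ∈ S, |h j| := by
  simp [l1, restr, apply_ite abs, Finset.sum_ite_mem]

theorem l2_restr_sq {p : ℕ} (h : Fin p → ℝ) (S : Finset (Fin p)) :
    l2 (restr h S) ^ 2 = ∑ j ∈ S, h j ^ 2 := by
  simp [l2_sq, restr, ite_pow, Finset.sum_ite_mem]

theorem restr_apply_of_notMem {p : ℕ} (h : Fin p → ℝ) {S : Finset (Fin p)} {j : Fin p}
    (hj : j ∉ S) : restr h S j = 0 := if_neg hj

theorem restr_sdiff_add {p : ℕ} (h : Fin p → ℝ) {S T : Finset (Fin p)} (hTS : T ⊆ S) :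
    restr h T + restr h (S \ T) = restr h S := by
  ext j
  have := @hTS j
  by_cases hT : j ∈ T <;> by_cases hS : j ∈ S <;> simp_all [restr]

theorem card_supp_le {p : ℕ} {v : Fin p → ℝ} {A : Finset (Fin p)}
    (hA : ∀ j, j ∉ A → v j = 0) : (supp v).card ≤ A.card := by
  refine Finset.card_le_card fun j hj => ?_
  by_contra hjA
  exact (Finset.mem_filter.1 hj).2 (hA j hjA)

theorem l2_restr_le {p s : ℕ} {h : Fin p → ℝ} {T : Finset (Fin p)} (hT : T.card ≤ s) {M : ℝ}
    (hM0 : 0 ≤ M) (hM : ∀ j ∈ T, |h j| ≤ M) : l2 (restr h T) ≤ √s * M := by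
  refine le_of_sq_le_sq ?_ (by positivity)
  rw [l2_restr_sq, mul_pow, Real.sq_sqrt (Nat.cast_nonneg s)]
  calc ∑ j ∈ T, h j ^ 2 ≤ ∑ _j ∈ T, M ^ 2 :=
        Finset.sum_le_sum fun j hj => sq_le_sq' (abs_le.1 (hM j hj)).1 (abs_le.1 (hM j hj)).2
    _ = T.card * M ^ 2 := by simp
    _ ≤ s * M ^ 2 := by gcongr

/-- A finite set of size at least `s` contains `s` elements at which `f` is largest. -/
theorem exists_top_subset {ι : Type*} [DecidableEq ι] (f : ι → ℝ) (S : Finset ι) :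
    ∀ s ≤ S.card, ∃ T ⊆ S, T.card = s ∧ ∀ i ∈ T, ∀ j ∈ S \ T, f j ≤ f i := by
  intro s
  induction s with
  | zero => exact fun _ => ⟨∅, by simp⟩
  | succ s ih =>
    intro hs
    obtain ⟨T, hTS, hTs, hT⟩ := ih (by omega)
    have hne : (S \ T).Nonempty := by
      rw [← Finset.card_pos, Finset.card_sdiff_of_subset hTS]
      omega
    obtain ⟨a, ha, hmax⟩ := Finset.exists_max_image (S \ T) f hne
    have ha' := Finset.mem_sdiff.1 ha
    refine ⟨insert a T, Finset.insert_subset ha'.1 hTS, ?_, fun i hi j hj => ?_⟩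
    · rw [Finset.card_insert_of_notMem ha'.2, hTs]
    · have hj' : j ∈ S \ T := by
        simp only [Finset.mem_sdiff, Finset.mem_insert, not_or] at hj ⊢
        exact ⟨hj.1, hj.2.2⟩
      rcases Finset.mem_insert.1 hi with rfl | hi
      · exact hmax j hj'
      · exact hT i hi j hj'

/-- A number below all of the `s` values `|h i|`, `i ∈ T`, is below their average. -/
theorem le_average {p s : ℕ} (hs : 1 ≤ s) {h : Fin p → ℝ} {T : Finset (Fin p)}
    (hT : T.card = s) {c : ℝ} (hc : ∀ i ∈ T, c ≤ |h i|) : c ≤ (∑ i ∈ T, |h i|) / s := by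
  have hs' : (0 : ℝ) < s := by exact_mod_cast hs
  rw [le_div_iff₀ hs']
  have := Finset.card_nsmul_le_sum T _ c hc
  rw [hT, nsmul_eq_mul] at this
  linarith

theorem sqrt_mul_div_self {s : ℝ} (hs : 0 < s) (a : ℝ) : √s * (a / s) = a / √s := by
  have h0 := Real.sqrt_pos.2 hs
  rw [mul_div_assoc', div_eq_div_iff hs.ne' h0.ne']
  linear_combination a * Real.mul_self_sqrt hs.le

/-- Shelling: a subadditive functional bounded by `C` times the `ℓ₂` norm on `s`-sparse vectors
supported in `S` is controlled on `h_S` by the `ℓ₁` norm of `h_S` and a bound on its entries. -/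
theorem shelling_bound {p s : ℕ} (hs : 1 ≤ s) (F : (Fin p → ℝ) → ℝ)
    (hF : ∀ u v, F (u + v) ≤ F u + F v) {C : ℝ} (hC : 0 ≤ C) (h : Fin p → ℝ)
    (S : Finset (Fin p)) (hFC : ∀ A ⊆ S, A.card ≤ s → F (restr h A) ≤ C * l2 (restr h A))
    {M : ℝ} (hM0 : 0 ≤ M) (hM : ∀ j ∈ S, |h j| ≤ M) :
    F (restr h S) ≤ C * (√s * M + (∑ j ∈ S, |h j|) / √s) := by
  induction S using Finset.strongInduction generalizing M with
  | H S ih =>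
    by_cases hS : S.card ≤ s
    · refine (hFC S subset_rfl hS).trans (mul_le_mul_of_nonneg_left ?_ hC)
      have : 0 ≤ (∑ j ∈ S, |h j|) / √s := by positivity
      linarith [l2_restr_le hS hM0 hM]
    · obtain ⟨T, hTS, hTs, hT⟩ := exists_top_subset (fun j => |h j|) S s (by omega)
      have hss : S \ T ⊂ S :=
        Finset.sdiff_ssubset hTS (Finset.card_pos.1 (by omega))
      have hrest := ih (S \ T) hss (fun A hA => hFC A (hA.trans Finset.sdiff_subset))
        (M := (∑ i ∈ T, |h i|) / s) (by positivity)
        (fun j hj => le_average hs hTs fun i hi => hT i hi j hj)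
      rw [sqrt_mul_div_self (by exact_mod_cast hs), ← add_div, add_comm (∑ i ∈ T, |h i|),
        Finset.sum_sdiff hTS] at hrest
      have hhead := (hFC T hTS hTs.le).trans (mul_le_mul_of_nonneg_left
        (l2_restr_le hTs.le hM0 fun j hj => hM j (hTS hj)) hC)
      rw [← restr_sdiff_add h hTS, mul_add]
      exact (hF _ _).trans (add_le_add hhead hrest)

/-- The shelling bound outside `T₀ ∪ T₁`, where `T₁` collects the largest entries outside `T₀`. -/
theorem shelling_bound_compl {p s : ℕ} (hs : 1 ≤ s) (F : (Fin p → ℝ) → ℝ)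
    (hF : ∀ u v, F (u + v) ≤ F u + F v) {C : ℝ} (hC : 0 ≤ C) {h : Fin p → ℝ}
    {T₀ T₁ : Finset (Fin p)} (hT₁ : TopSetOutside h s T₀ T₁)
    (hFC : ∀ A ⊆ (T₀ ∪ T₁)ᶜ, A.card ≤ s → F (restr h A) ≤ C * l2 (restr h A)) :
    F (restr h (T₀ ∪ T₁)ᶜ) ≤ C * (l1 (restr h T₀ᶜ) / √s) := by
  obtain ⟨hcard, hdisj, htop⟩ := hT₁
  have hb := shelling_bound hs F hF hC h (T₀ ∪ T₁)ᶜ hFC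
    (M := (∑ i ∈ T₁, |h i|) / s) (by positivity) fun j hj => by
      simp only [Finset.mem_compl, Finset.mem_union, not_or] at hj
      exact le_average hs hcard fun i hi => htop i hi j hj.1 hj.2
  have hsub : T₁ ⊆ T₀ᶜ := fun j hj =>
    Finset.mem_compl.2 (Finset.disjoint_right.1 hdisj hj)
  have hdiff : (T₀ ∪ T₁)ᶜ = T₀ᶜ \ T₁ := by
    ext j
    simp
  rw [sqrt_mul_div_self (by exact_mod_cast hs), ← add_div, hdiff, add_comm (∑ i ∈ T₁, |h i|),
    Finset.sum_sdiff hsub, ← l1_restr] at hb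
  rwa [hdiff]

theorem l2_mulVec_le_of_isLambdaMax {n p m : ℕ} (hn : 0 < n) {X : Matrix (Fin n) (Fin p) ℝ}
    {L : ℝ} (hL : IsLambdaMax X m L) {v : Fin p → ℝ} (hv : (supp v).card ≤ m) :
    l2 (X.mulVec v) / √n ≤ √L * l2 v := by
  have hn' : (0 : ℝ) < n := by exact_mod_cast hn
  by_cases h0 : v = 0
  · simp [h0, l2_zero]
  have hv0 := l2_pos h0
  have hL0 : 0 ≤ L := hL.2 (Set.mem_insert _ _)
  have hle := hL.2 (Set.mem_insert_of_mem _ ⟨v, h0, hv, rfl⟩)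
  rw [div_le_iff₀ (by positivity)] at hle
  refine le_of_sq_le_sq ?_ (by positivity)
  rw [div_pow, mul_pow, Real.sq_sqrt hn'.le, Real.sq_sqrt hL0, div_le_iff₀ hn']
  linarith

theorem le_l2_mulVec_of_isLambdaMin {n p m : ℕ} (hn : 0 < n) {X : Matrix (Fin n) (Fin p) ℝ}
    {L : ℝ} (hL : IsLambdaMin X m L) (hL0 : 0 ≤ L) {v : Fin p → ℝ} (hv : (supp v).card ≤ m) :
    √L * l2 v ≤ l2 (X.mulVec v) / √n := by
  have hn' : (0 : ℝ) < n := by exact_mod_cast hn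
  by_cases h0 : v = 0
  · simp [h0, l2_zero]
  have hv0 := l2_pos h0
  have hle := hL.2 ⟨v, h0, hv, rfl⟩
  rw [le_div_iff₀ (by positivity)] at hle
  refine le_of_sq_le_sq ?_ (div_nonneg (l2_nonneg _) (Real.sqrt_nonneg _))
  rw [div_pow, mul_pow, Real.sq_sqrt hn'.le, Real.sq_sqrt hL0, le_div_iff₀ hn']
  linarith

/-- simple bound on `‖X h_{T₀₁}‖` and the resulting `ℓ₂` bound on
`h_{T₀₁}` with the constant `ℓ(s₀)`. -/
theorem statement_8
    (n p s₀ : ℕ) (hn : 0 < n) (hs₀ : 1 ≤ s₀) (h3s₀ : 3 * s₀ ≤ p)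
    (X : Matrix (Fin n) (Fin p) ℝ)
    (Lmin2s0 : ℝ) (hLmin : IsLambdaMin X (2 * s₀) Lmin2s0) (hpos : 0 < Lmin2s0)
    (Lmaxs0 : ℝ) (hLmaxs0 : IsLambdaMax X s₀ Lmaxs0)
    (h : Fin p → ℝ)
    (T₀ : Finset (Fin p)) (hT₀ : T₀.card = s₀)
    (T₁ : Finset (Fin p)) (hT₁ : TopSetOutside h s₀ T₀ T₁)
    (T₀₁ : Finset (Fin p)) (hT₀₁ : T₀₁ = T₀ ∪ T₁)
    (θ ell : ℝ) (hθ : IsTheta X s₀ (2 * s₀) θ)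
    (hell : ell = min (θ / Real.sqrt Lmin2s0) (Real.sqrt Lmaxs0)) :
    l2 (X.mulVec (restr h T₀₁)) / Real.sqrt n ≤
      l2 (X.mulVec h) / Real.sqrt n + Real.sqrt Lmaxs0 * (l1 (restr h T₀ᶜ) / Real.sqrt s₀) ∧
    l2 (restr h T₀₁) ≤
      (1 / Real.sqrt Lmin2s0) *
        (l2 (X.mulVec h) / Real.sqrt n + ell * (l1 (restr h T₀ᶜ) / Real.sqrt s₀)) := by
  subst hT₀₁ hell
  have hn' : (0 : ℝ) < n := by exact_mod_cast hn
  have hsn : 0 < √(n : ℝ) := Real.sqrt_pos.2 hn'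
  have hsL : 0 < √Lmin2s0 := Real.sqrt_pos.2 hpos
  have hcard : (T₀ ∪ T₁).card ≤ 2 * s₀ :=
    (Finset.card_union_le _ _).trans (by rw [hT₀, hT₁.1]; omega)
  have hsum : restr h (T₀ ∪ T₁) + restr h (T₀ ∪ T₁)ᶜ = h := by
    ext j
    by_cases hj : j ∈ T₀ ∪ T₁ <;> simp only [Pi.add_apply, restr, hj, Finset.mem_compl] <;> simp
  set w := restr h (T₀ ∪ T₁) with hw
  set z := restr h (T₀ ∪ T₁)ᶜ with hz
  set R := l1 (restr h T₀ᶜ) / √(s₀ : ℝ) with hR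
  have hw0 : ∀ j, j ∉ T₀ ∪ T₁ → w j = 0 := fun j hj => restr_apply_of_notMem h hj
  have hXw : X.mulVec w = X.mulVec h - X.mulVec z := by
    rw [← Matrix.mulVec_sub, ← hsum, add_sub_cancel_right]
  have hR0 : 0 ≤ R := div_nonneg (by rw [l1_restr]; positivity) (Real.sqrt_nonneg _)
  have hzmax : l2 (X.mulVec z) / √n ≤ √Lmaxs0 * R :=
    shelling_bound_compl hs₀ (fun u => l2 (X.mulVec u) / √n)
      (fun u v => by
        rw [Matrix.mulVec_add, ← add_div]
        exact div_le_div_of_nonneg_right (l2_add_le _ _) hsn.le)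
      (Real.sqrt_nonneg _) hT₁ fun A _ hAs =>
        l2_mulVec_le_of_isLambdaMax hn hLmaxs0
          ((card_supp_le fun j hj => restr_apply_of_notMem h hj).trans hAs)
  have hfirst : l2 (X.mulVec w) / √n ≤ l2 (X.mulVec h) / √n + √Lmaxs0 * R := by
    have := div_le_div_of_nonneg_right (l2_sub_le (X.mulVec h) (X.mulVec z)) hsn.le
    rw [← hXw, add_div] at this
    linarith
  have hmin := le_l2_mulVec_of_isLambdaMin hn hLmin hpos.le ((card_supp_le hw0).trans hcard)
  have hzθ : |∑ i, X.mulVec z i * X.mulVec w i| / n ≤ θ * l2 w * R :=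
    shelling_bound_compl hs₀ (fun u => |∑ i, X.mulVec u i * X.mulVec w i| / n)
      (fun u v => by
        simp only [Matrix.mulVec_add, Pi.add_apply, add_mul, Finset.sum_add_distrib, ← add_div]
        exact div_le_div_of_nonneg_right (abs_add_le _ _) hn'.le)
      (mul_nonneg hθ.1.1 (l2_nonneg w)) hT₁ fun A hA hAs => by
        have := hθ.1.2 (restr h A) w A (T₀ ∪ T₁)
          (Finset.disjoint_of_subset_left hA disjoint_compl_left) hAs hcard
          (fun j hj => restr_apply_of_notMem h hj) hw0
        linarith
  have hsecond : l2 (X.mulVec w) / √n ≤ l2 (X.mulVec h) / √n + θ / √Lmin2s0 * R := by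
    have hb0 : 0 ≤ l2 (X.mulVec h) / √n := div_nonneg (l2_nonneg _) hsn.le
    have hθR : 0 ≤ θ / √Lmin2s0 * R := mul_nonneg (div_nonneg hθ.1.1 hsL.le) hR0
    rcases (div_nonneg (l2_nonneg (X.mulVec w)) hsn.le).eq_or_lt with ha | ha
    · rw [← ha]
      positivity
    refine le_of_mul_le_mul_right ?_ ha
    have hsq : l2 (X.mulVec w) ^ 2
        = ∑ i, X.mulVec h i * X.mulVec w i - ∑ i, X.mulVec z i * X.mulVec w i := by
      rw [l2_sq, ← Finset.sum_sub_distrib]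
      refine Finset.sum_congr rfl fun i _ => ?_
      rw [← sub_mul, ← Pi.sub_apply, ← hXw, sq]
    have hwle : l2 w ≤ l2 (X.mulVec w) / √n / √Lmin2s0 := by
      rw [le_div_iff₀ hsL]
      linarith
    calc l2 (X.mulVec w) / √n * (l2 (X.mulVec w) / √n)
        = l2 (X.mulVec w) ^ 2 / n := by
          rw [div_mul_div_comm, Real.mul_self_sqrt hn'.le, sq]
      _ ≤ (l2 (X.mulVec h) * l2 (X.mulVec w) + |∑ i, X.mulVec z i * X.mulVec w i|) / n := by
          rw [hsq]
          refine div_le_div_of_nonneg_right ?_ hn'.le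
          linarith [sum_mul_le_l2 (X.mulVec h) (X.mulVec w),
            neg_abs_le (∑ i, X.mulVec z i * X.mulVec w i)]
      _ = l2 (X.mulVec h) / √n * (l2 (X.mulVec w) / √n)
            + |∑ i, X.mulVec z i * X.mulVec w i| / n := by
          rw [div_mul_div_comm, Real.mul_self_sqrt hn'.le, add_div]
      _ ≤ l2 (X.mulVec h) / √n * (l2 (X.mulVec w) / √n)
            + θ * (l2 (X.mulVec w) / √n / √Lmin2s0) * R := by
          refine add_le_add_right (hzθ.trans ?_) _
          exact mul_le_mul_of_nonneg_right (mul_le_mul_of_nonneg_left hwle hθ.1.1) hR0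
      _ = (l2 (X.mulVec h) / √n + θ / √Lmin2s0 * R) * (l2 (X.mulVec w) / √n) := by ring
  refine ⟨hfirst, ?_⟩
  rw [one_div_mul_eq_div, le_div_iff₀ hsL, mul_comm, min_mul_of_nonneg _ _ hR0,
    ← min_add_add_left]
  exact hmin.trans (le_min hsecond hfirst)

end ThreshLasso
end
end

section
/- Let p ≥ 2, n ≥ 1, let β ∈ ℝ^p satisfy |β_1| ≥ |β_2| ≥ … ≥ |β_p|, let σ > 0 and λ = √(2·log p/n), let s₀ be the essential sparsity of β, let A₀ = {j : |β_j| > λσ}, and a₀ = |A₀|. Then a₀ ≤ s₀, and for every real number c' > 1/2, the number of indices j with j > s₀ and |β_j| ≥ σ·√(log p/(c'·n)) is at most (2c' − 1)·(s₀ − a₀). -/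
open Finset Matrix Real
open scoped BigOperators Classical

noncomputable section

namespace ThreshLasso

/-- If all entries of `A` are above `M` and all entries of `D ⊇ A` are above `t * M`, the truncated
sum dominates the corresponding count. -/
theorem card_mul_add_card_mul_le_sum_min {ι : Type*} [Fintype ι] {x : ι → ℝ} {M t : ℝ}
    (hM : 0 ≤ M) (ht : t ≤ 1) (hx : ∀ j, 0 ≤ x j) {A D : Finset ι} (hAD : A ⊆ D)
    (hA : ∀ j ∈ A, M ≤ x j) (hD : ∀ j ∈ D, t * M ≤ x j) :
    (A.card : ℝ) * ((1 - t) * M) + D.card * (t * M) ≤ ∑ j, min (x j) M := by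
  have hind (S : Finset ι) (r : ℝ) : (S.card : ℝ) * r = ∑ j, if j ∈ S then r else 0 := by
    simp
  rw [hind A, hind D, ← Finset.sum_add_distrib]
  refine Finset.sum_le_sum fun j _ => ?_
  have htM : t * M ≤ M := mul_le_of_le_one_left hM ht
  by_cases hjA : j ∈ A
  · have hmin : min (x j) M = M := min_eq_right (hA j hjA)
    rw [if_pos hjA, if_pos (hAD hjA), hmin]
    linarith
  · by_cases hjD : j ∈ D
    · rw [if_neg hjA, if_pos hjD, zero_add]
      exact le_min (hD j hjD) htM
    · rw [if_neg hjA, if_neg hjD, zero_add]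
      exact le_min (hx j) hM

/-- If a downward closed predicate on `Fin p` holds at some index `≥ s`, it holds at all
indices `< s`, so at least `s` of the indices where it holds are `< s`. -/
theorem add_card_filter_le_card_filter {p s : ℕ} {P : Fin p → Prop}
    (hP : ∀ i j, i ≤ j → P j → P i)
    (hne : (Finset.univ.filter fun j : Fin p => s ≤ (j : ℕ) ∧ P j).Nonempty) :
    s + (Finset.univ.filter fun j : Fin p => s ≤ (j : ℕ) ∧ P j).card ≤
      (Finset.univ.filter P).card := by
  obtain ⟨k, hk⟩ := hne
  simp only [Finset.mem_filter, Finset.mem_univ, true_and] at hk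
  have hcard : (Finset.univ.filter fun j : Fin p => (j : ℕ) < s).card = s := by
    rw [Fin.card_filter_val_lt]
    exact min_eq_right (hk.1.trans k.isLt.le)
  have hdisj : Disjoint (Finset.univ.filter fun j : Fin p => (j : ℕ) < s)
      (Finset.univ.filter fun j : Fin p => s ≤ (j : ℕ) ∧ P j) := by
    rw [Finset.disjoint_filter]
    intro j _ h h'
    omega
  calc s + (Finset.univ.filter fun j : Fin p => s ≤ (j : ℕ) ∧ P j).card
      = ((Finset.univ.filter fun j : Fin p => (j : ℕ) < s) ∪
          Finset.univ.filter fun j : Fin p => s ≤ (j : ℕ) ∧ P j).card := by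
        rw [Finset.card_union_of_disjoint hdisj, hcard]
    _ ≤ (Finset.univ.filter P).card := by
        refine Finset.card_le_card fun j hj => ?_
        simp only [Finset.mem_union, Finset.mem_filter, Finset.mem_univ, true_and] at hj ⊢
        rcases hj with h | h
        · exact hP j k (Fin.le_def.mpr (h.le.trans hk.1)) hk.2
        · exact h.2

/-- counting coordinates above `σ√(log p/(c'n))` beyond `s₀`. -/
theorem statement_11
    (p n : ℕ) (hp : 2 ≤ p) (hn : 1 ≤ n) (β : Fin p → ℝ)
    (hmono : ∀ i j : Fin p, i ≤ j → |β j| ≤ |β i|)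
    (σ lam : ℝ) (hσ : 0 < σ) (hlam : lam = Real.sqrt (2 * Real.log p / n))
    (s₀ : ℕ) (hess : EssSparsity β lam σ s₀)
    (A₀ : Finset (Fin p)) (hA₀ : A₀ = Finset.univ.filter fun j => lam * σ < |β j|)
    (a₀ : ℕ) (ha₀ : a₀ = A₀.card) :
    a₀ ≤ s₀ ∧
    ∀ c' : ℝ, 1 / 2 < c' →
      ((Finset.univ.filter fun j : Fin p =>
          s₀ ≤ (j : ℕ) ∧ σ * Real.sqrt (Real.log p / (c' * n)) ≤ |β j|).card : ℝ) ≤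
        (2 * c' - 1) * ((s₀ : ℝ) - a₀) := by
  have hn' : (0 : ℝ) < n := by exact_mod_cast hn
  have hlog : 0 < Real.log p := Real.log_pos (by exact_mod_cast hp)
  have hlam_pos : 0 < lam := by rw [hlam]; positivity
  have hlam_sq : lam ^ 2 = 2 * Real.log p / n := by
    rw [hlam, Real.sq_sqrt (by positivity)]
  have hM : 0 < lam ^ 2 * σ ^ 2 := by positivity
  have hsum := hess.1
  simp only [Set.mem_ofPred_eq] at hsum
  have hA : ∀ j ∈ A₀, lam ^ 2 * σ ^ 2 ≤ β j ^ 2 := by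
    intro j hj
    rw [hA₀, Finset.mem_filter] at hj
    rw [← mul_pow, ← sq_abs (β j)]
    exact pow_le_pow_left₀ (by positivity) hj.2.le 2
  have hle : a₀ ≤ s₀ := by
    have h := card_mul_add_card_mul_le_sum_min hM.le le_rfl (fun j => sq_nonneg (β j))
      (Finset.Subset.refl A₀) hA (by simpa using hA)
    rw [← ha₀] at h
    have h' : (a₀ : ℝ) * (lam ^ 2 * σ ^ 2) ≤ s₀ * (lam ^ 2 * σ ^ 2) := by linarith
    exact_mod_cast le_of_mul_le_mul_right h' hM
  have hle' : (a₀ : ℝ) ≤ s₀ := by exact_mod_cast hle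
  refine ⟨hle, fun c' hc' => ?_⟩
  have hc : 0 < c' := by linarith
  set τ := σ * Real.sqrt (Real.log p / (c' * n)) with hτ
  have hτ_nonneg : 0 ≤ τ := by positivity
  have hτ_sq : τ ^ 2 = 1 / (2 * c') * (lam ^ 2 * σ ^ 2) := by
    rw [hτ, mul_pow, Real.sq_sqrt (by positivity), hlam_sq]
    field_simp
  have ht : 1 / (2 * c') ≤ 1 := by
    rw [div_le_one (by positivity)]
    linarith
  rcases (Finset.univ.filter fun j : Fin p => s₀ ≤ (j : ℕ) ∧ τ ≤ |β j|).eq_empty_or_nonempty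
    with hB | hB
  · rw [hB, Finset.card_empty, Nat.cast_zero]
    exact mul_nonneg (by linarith) (by linarith)
  have hcard := add_card_filter_le_card_filter (P := fun j => τ ≤ |β j|)
    (fun i j hij h => h.trans (hmono i j hij)) hB
  set b := (Finset.univ.filter fun j : Fin p => s₀ ≤ (j : ℕ) ∧ τ ≤ |β j|).card
  have hτ_le : τ ≤ lam * σ := by
    refine le_of_sq_le_sq ?_ (by positivity)
    rw [hτ_sq, mul_pow]
    exact mul_le_of_le_one_left hM.le ht
  have hAD : A₀ ⊆ Finset.univ.filter fun j => τ ≤ |β j| := by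
    rw [hA₀]
    exact Finset.monotone_filter_right _ fun j _ h => hτ_le.trans h.le
  have h := card_mul_add_card_mul_le_sum_min hM.le ht (fun j => sq_nonneg (β j)) hAD hA
    fun j hj => by
      rw [← hτ_sq, ← sq_abs (β j)]
      exact pow_le_pow_left₀ hτ_nonneg (Finset.mem_filter.mp hj).2 2
  rw [← ha₀] at h
  have hcard' : (s₀ : ℝ) + b ≤ (Finset.univ.filter fun j => τ ≤ |β j|).card := by
    exact_mod_cast hcard
  have hcount : (a₀ : ℝ) * (1 - 1 / (2 * c')) + (s₀ + b) * (1 / (2 * c')) ≤ s₀ := by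
    refine le_of_mul_le_mul_right ?_ hM
    have := mul_le_mul_of_nonneg_right hcard' (hτ_sq ▸ sq_nonneg τ)
    linarith
  have hscaled := mul_le_mul_of_nonneg_left hcount (by positivity : 0 ≤ 2 * c')
  have hexpand : 2 * c' * ((a₀ : ℝ) * (1 - 1 / (2 * c')) + (s₀ + b) * (1 / (2 * c'))) =
      (2 * c' - 1) * a₀ + (s₀ + b) := by
    field_simp
  linarith

end ThreshLasso
end
end

section
/- Let n, p ≥ 1, let X be an n×p real matrix, let f, ξ ∈ ℝⁿ, y = f + ξ, and let h : ℝ^p → ℝ be a convex function. If β̂ ∈ ℝ^p minimizes the function b ↦ ‖Xb − y‖₂²/n + h(b) over ℝ^p, then for every β̃ ∈ ℝ^p: ‖Xβ̂ − f‖₂²/n + ‖X(β̂ − β̃)‖₂²/n ≤ ‖f − Xβ̃‖₂²/n + (2/n)·ξᵀX(β̂ − β̃) + h(β̃) − h(β̂). -/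
open Finset Matrix Real
open scoped BigOperators Classical

noncomputable section

namespace ThreshLasso

theorem l2_sq_neg {m : ℕ} (v : Fin m → ℝ) : l2 (-v) ^ 2 = l2 v ^ 2 := by
  simp [l2_sq]

theorem l2_sq_add_smul {m : ℕ} (u v : Fin m → ℝ) (t : ℝ) :
    l2 (u + t • v) ^ 2 = l2 u ^ 2 + 2 * t * (u ⬝ᵥ v) + t ^ 2 * l2 v ^ 2 := by
  simp only [l2_sq, dotProduct, Finset.mul_sum, ← Finset.sum_add_distrib, Pi.add_apply,
    Pi.smul_apply, smul_eq_mul]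
  exact Finset.sum_congr rfl fun i _ => by ring

theorem nonneg_of_forall_nonneg_add_mul {a b : ℝ}
    (hab : ∀ t : ℝ, 0 < t → t ≤ 1 → 0 ≤ a + t * b) : 0 ≤ a := by
  have hlim : Filter.Tendsto (fun t : ℝ => a + t * b) (nhdsWithin 0 (Set.Ioi 0)) (nhds a) := by
    have hc : Continuous fun t : ℝ => a + t * b := by fun_prop
    simpa using (hc.tendsto 0).mono_left nhdsWithin_le_nhds
  refine ge_of_tendsto hlim ?_
  filter_upwards [Ioc_mem_nhdsGT (zero_lt_one' ℝ)] with t ht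
  exact hab t ht.1 ht.2

/-- First-order optimality condition for least squares with a convex penalty. -/
theorem first_order_condition {n p : ℕ} (X : Matrix (Fin n) (Fin p) ℝ) (y : Fin n → ℝ)
    {h : (Fin p → ℝ) → ℝ} (hconv : ConvexOn ℝ Set.univ h) {b : Fin p → ℝ}
    (hmin : ∀ b' : Fin p → ℝ,
      l2 (X.mulVec b - y) ^ 2 / n + h b ≤ l2 (X.mulVec b' - y) ^ 2 / n + h b')
    (d : Fin p → ℝ) :
    0 ≤ 2 * ((X.mulVec b - y) ⬝ᵥ X.mulVec d) / n + (h (b + d) - h b) := by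
  refine nonneg_of_forall_nonneg_add_mul (b := l2 (X.mulVec d) ^ 2 / n) fun t ht ht1 => ?_
  have hle := hmin (b + t • d)
  have hres : X.mulVec (b + t • d) - y = (X.mulVec b - y) + t • X.mulVec d := by
    rw [Matrix.mulVec_add, Matrix.mulVec_smul]
    abel
  rw [hres, l2_sq_add_smul] at hle
  have hcomb : (1 - t) • b + t • (b + d) = b + t • d := by module
  have hc := hconv.2 (Set.mem_univ b) (Set.mem_univ (b + d)) (sub_nonneg.2 ht1) ht.le
    (sub_add_cancel 1 t)
  rw [hcomb, smul_eq_mul, smul_eq_mul] at hc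
  refine nonneg_of_mul_nonneg_right ?_ ht
  simp only [add_div, mul_div_assoc] at hle ⊢
  linear_combination hle + hc

/-- basic inequality for penalized least squares with a convex
penalty (Lemma A.2 of Bellec–Lecué–Tsybakov). -/
theorem statement_14
    (n p : ℕ) (hn : 1 ≤ n) (hp : 1 ≤ p)
    (X : Matrix (Fin n) (Fin p) ℝ) (f ξ y : Fin n → ℝ) (hy : y = f + ξ)
    (h : (Fin p → ℝ) → ℝ) (hconv : ConvexOn ℝ Set.univ h)
    (βhat : Fin p → ℝ)
    (hmin : ∀ b : Fin p → ℝ,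
      (l2 (X.mulVec βhat - y)) ^ 2 / n + h βhat ≤ (l2 (X.mulVec b - y)) ^ 2 / n + h b)
    (βtilde : Fin p → ℝ) :
    (l2 (X.mulVec βhat - f)) ^ 2 / n + (l2 (X.mulVec (βhat - βtilde))) ^ 2 / n ≤
      (l2 (f - X.mulVec βtilde)) ^ 2 / n +
        (2 / n) * (∑ i, ξ i * X.mulVec (βhat - βtilde) i) + h βtilde - h βhat := by
  have hopt := first_order_condition X y hconv hmin (βtilde - βhat)
  have hfit : f - X.mulVec βtilde =
      -((X.mulVec βhat - f) + (1 : ℝ) • X.mulVec (βtilde - βhat)) := by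
    rw [Matrix.mulVec_sub, one_smul]
    abel
  have hneg : X.mulVec (βhat - βtilde) = -X.mulVec (βtilde - βhat) := by
    rw [← Matrix.mulVec_neg, neg_sub]
  have hsum : ∑ i, ξ i * X.mulVec (βhat - βtilde) i = -(ξ ⬝ᵥ X.mulVec (βtilde - βhat)) := by
    rw [hneg, ← dotProduct_neg]
    rfl
  rw [hsum, hfit, l2_sq_neg, l2_sq_add_smul, hneg, l2_sq_neg]
  rw [add_sub_cancel, hy, ← sub_sub, sub_dotProduct] at hopt
  linear_combination hopt

end ThreshLasso
end
end
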